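/- Let A be a unital associative algebra over a commutative unital ring R that is (n−1)-torsion free, let e be a nontrivial idempotent in A and f = 1 − e, suppose A satisfies property (Q), let n ≥ 2, and let φ be a Lie n-derivation on A. If (i) fφ(a)f ∈ fZ(A)f for every a ∈ eAe and eφ(b)e ∈ eZ(A)e for every b ∈ fAf, and (ii) eAe has no nonzero central ideal or fAf has no nonzero central ideal, then eφ(tm)e + fφ(mt)f ∈ Z(A) for every m ∈ eAf and t ∈ fAe. -/

import Mathlib

open Finset

/-- Iterated commutator: `pCom x k = p_{k+1}(x 0, ..., x k)`, i.e.
`pCom x 0 = x 0` and `pCom x (k+1) = [pCom x k, x (k+1)]`. -/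
def pCom {A : Type*} [Ring A] (x : ℕ → A) : ℕ → A
  | 0 => x 0
  | k + 1 => pCom x k * x (k + 1) - x (k + 1) * pCom x k

/-- `φ` is a Lie `n`-derivation. -/
def IsLieNDeriv {R : Type*} {A : Type*} [CommRing R] [Ring A] [Algebra R A]
    (n : ℕ) (φ : A →ₗ[R] A) : Prop :=
  ∀ x : ℕ → A,
    φ (pCom x (n - 1)) =
      ∑ i ∈ Finset.range n, pCom (Function.update x i (φ (x i))) (n - 1)

/-- `d` is a derivation. -/
def IsDeriv {R : Type*} {A : Type*} [CommRing R] [Ring A] [Algebra R A]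
    (d : A →ₗ[R] A) : Prop :=
  ∀ x y : A, d (x * y) = d x * y + x * d y

/-- `δ` is a Jordan derivation. -/
def IsJordanDeriv {R : Type*} {A : Type*} [CommRing R] [Ring A] [Algebra R A]
    (δ : A →ₗ[R] A) : Prop :=
  ∀ x y : A, δ (x * y + y * x) = δ x * y + y * δ x + x * δ y + δ y * x

/-- `δ` is an antiderivation. -/
def IsAntiDeriv {R : Type*} {A : Type*} [CommRing R] [Ring A] [Algebra R A]
    (δ : A →ₗ[R] A) : Prop :=
  ∀ x y : A, δ (x * y) = δ y * x + y * δ x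

/-- `δ` is a singular Jordan derivation relative to the idempotent `e`
(with `f = 1 - e`): it is a Jordan derivation killing `eAe` and `fAf`,
mapping `eAf` into `fAe` and `fAe` into `eAf`. -/
def IsSingularJordanDeriv {R : Type*} {A : Type*} [CommRing R] [Ring A] [Algebra R A]
    (e : A) (δ : A →ₗ[R] A) : Prop :=
  IsJordanDeriv δ ∧
  (∀ a : A, δ (e * a * e) = 0) ∧
  (∀ b : A, δ ((1 - e) * b * (1 - e)) = 0) ∧
  (∀ m : A, δ (e * m * (1 - e)) = (1 - e) * δ (e * m * (1 - e)) * e) ∧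
  (∀ t : A, δ ((1 - e) * t * e) = e * δ ((1 - e) * t * e) * (1 - e))

/-- `z` is a central element. -/
def IsCent {A : Type*} [Ring A] (z : A) : Prop := ∀ y : A, z * y = y * z

/-- The centre of `A` as a set. -/
def centerSet (A : Type*) [Ring A] : Set A := {z : A | ∀ y : A, z * y = y * z}

/-- `γ` vanishes on all `(n-1)`-th commutators. -/
def VanishesOnNCommutators {R : Type*} {A : Type*} [CommRing R] [Ring A] [Algebra R A]
    (n : ℕ) (γ : A →ₗ[R] A) : Prop :=
  ∀ x : ℕ → A, γ (pCom x (n - 1)) = 0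

/-- A Lie `n`-derivation is standard if it is the sum of a derivation and a
central-valued map vanishing on all `(n-1)`-th commutators. -/
def IsStandardLieNDeriv {R : Type*} {A : Type*} [CommRing R] [Ring A] [Algebra R A]
    (n : ℕ) (φ : A →ₗ[R] A) : Prop :=
  ∃ d γ : A →ₗ[R] A,
    IsDeriv d ∧ (∀ x : A, IsCent (γ x)) ∧ VanishesOnNCommutators n γ ∧ φ = d + γ

/-- Property (Q) for the idempotent `e` (with `f = 1 - e`):
`exe·eAf = 0 = fAe·exe` implies `exe = 0`, and
`eAf·fxf = 0 = fxf·fAe` implies `fxf = 0`. -/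
def PropQ {A : Type*} [Ring A] (e : A) : Prop :=
  (∀ x : A,
    ((∀ y : A, (e * x * e) * (e * y * (1 - e)) = 0) ∧
     (∀ y : A, ((1 - e) * y * e) * (e * x * e) = 0)) → e * x * e = 0) ∧
  (∀ x : A,
    ((∀ y : A, (e * y * (1 - e)) * ((1 - e) * x * (1 - e)) = 0) ∧
     (∀ y : A, ((1 - e) * x * (1 - e)) * ((1 - e) * y * e) = 0)) →
        (1 - e) * x * (1 - e) = 0)

/-- `A` is `k`-torsion free. -/
def TorsionFreeAt (A : Type*) [Ring A] (k : ℕ) : Prop :=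
  ∀ x : A, k • x = 0 → x = 0

/-- The centre of the corner algebra `gAg` (for an idempotent `g`). -/
def cornerCenter {A : Type*} [Ring A] (g : A) : Set A :=
  {z : A | z = g * z * g ∧ ∀ a : A, z * (g * a * g) = (g * a * g) * z}

/-- The corner algebra `gAg` has no nonzero central ideal: every
ideal of `gAg` consisting of elements central in `gAg` is zero. -/
def NoNonzeroCentralIdeal (R : Type*) [CommRing R] (A : Type*) [Ring A] [Algebra R A]
    (g : A) : Prop :=
  ∀ I : Set A, (0 : A) ∈ I →
    (∀ x ∈ I, x = g * x * g) →
    (∀ x ∈ I, ∀ y ∈ I, x + y ∈ I) →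
    (∀ r : R, ∀ x ∈ I, r • x ∈ I) →
    (∀ x ∈ I, ∀ a : A, (g * a * g) * x ∈ I) →
    (∀ x ∈ I, ∀ a : A, x * (g * a * g) ∈ I) →
    (∀ x ∈ I, ∀ a : A, x * (g * a * g) = (g * a * g) * x) →
    ∀ x ∈ I, x = 0

/-- The generating set of `S(gAg)`: all idempotents of `gAg` together with all
commutators of elements of `gAg`. -/
def cornerGenSet {A : Type*} [Ring A] (g : A) : Set A :=
  {x : A | x = g * x * g ∧ x * x = x} ∪
  {x : A | ∃ a b : A, x = (g * a * g) * (g * b * g) - (g * b * g) * (g * a * g)}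

/-- `gAg = S(gAg)`: the corner algebra is generated (as an algebra) by its
idempotents and commutators. -/
def CornerGenerated (R : Type*) [CommRing R] {A : Type*} [Ring A] [Algebra R A]
    (g : A) : Prop :=
  ∀ x : A, g * x * g ∈ NonUnitalAlgebra.adjoin R (cornerGenSet g)

/-- Condition (*) for the corner algebra `gAg`: if `[x, gAg] ⊆ Z(gAg)` then
`x ∈ Z(gAg)`. -/
def CornerCondStar {A : Type*} [Ring A] (g : A) : Prop :=
  ∀ x : A, x = g * x * g →
    (∀ a : A, x * (g * a * g) - (g * a * g) * x ∈ cornerCenter g) →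
    x ∈ cornerCenter g

/-- The formal Leibniz expansion of `φ (pCom x k)`. -/
def dCom {A : Type*} [Ring A] (φ : A → A) (x : ℕ → A) : ℕ → A
  | 0 => φ (x 0)
  | k + 1 => (dCom φ x k * x (k + 1) - x (k + 1) * dCom φ x k) +
      (pCom x k * φ (x (k + 1)) - φ (x (k + 1)) * pCom x k)

theorem pCom_congr {A : Type*} [Ring A] {x y : ℕ → A} {k : ℕ}
    (h : ∀ i ≤ k, x i = y i) : pCom x k = pCom y k := by
  induction k with
  | zero => exact h 0 le_rfl
  | succ k ih =>
    simp only [pCom]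
    rw [ih fun i hi => h i (by omega), h (k + 1) le_rfl]

theorem sum_pCom_update {A : Type*} [Ring A] (φ : A → A) (x : ℕ → A) (k : ℕ) :
    ∑ i ∈ Finset.range (k + 1), pCom (Function.update x i (φ (x i))) k = dCom φ x k := by
  induction k with
  | zero => simp [pCom, dCom]
  | succ k ih =>
    rw [Finset.sum_range_succ]
    simp only [dCom, ← ih, Finset.sum_mul, Finset.mul_sum, ← Finset.sum_sub_distrib]
    congr 1
    · refine Finset.sum_congr rfl fun i hi => ?_
      have hik : k + 1 ≠ i := by have := Finset.mem_range.1 hi; omega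
      simp only [pCom, Function.update_of_ne hik]
    · have h : pCom (Function.update x (k + 1) (φ (x (k + 1)))) k = pCom x k :=
        pCom_congr fun i hi => Function.update_of_ne (by omega) _ _
      simp only [pCom, Function.update_self, h]

theorem dCom_sub_commutator {A : Type*} [Ring A] (φ : A → A) (w : A) (x : ℕ → A) (k : ℕ) :
    dCom (fun y => φ y - (y * w - w * y)) x k =
      dCom φ x k - (pCom x k * w - w * pCom x k) := by
  induction k with
  | zero => rfl
  | succ k ih => simp only [dCom, pCom, ih]; noncomm_ring

/-- `e` and `f` are idempotents with `e + f = 1`. -/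
structure ComplementaryIdem {A : Type*} [Ring A] (e f : A) : Prop where
  add : e + f = 1
  ee : e * e = e
  ff : f * f = f
  ef : e * f = 0
  fe : f * e = 0

namespace ComplementaryIdem

variable {A : Type*} [Ring A] {e f : A}

theorem of_idem (he : e * e = e) : ComplementaryIdem e (1 - e) :=
  ⟨by abel, he, by simp [mul_sub, sub_mul, he], by simp [mul_sub, he], by simp [sub_mul, he]⟩

theorem symm (h : ComplementaryIdem e f) : ComplementaryIdem f e :=
  ⟨by rw [add_comm]; exact h.add, h.ff, h.ee, h.fe, h.ef⟩

theorem ee' (h : ComplementaryIdem e f) (x : A) : e * (e * x) = e * x := by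
  rw [← mul_assoc, h.ee]

theorem ef' (h : ComplementaryIdem e f) (x : A) : e * (f * x) = 0 := by
  rw [← mul_assoc, h.ef, zero_mul]

theorem decomp (h : ComplementaryIdem e f) (x : A) :
    x = e * x * e + e * x * f + f * x * e + f * x * f := by
  calc x = (e + f) * x * (e + f) := by rw [h.add]; simp
    _ = _ := by noncomm_ring

end ComplementaryIdem

/-- The half of property (Q) concerning the corner `eAe`. -/
def CornerFaithful {A : Type*} [Ring A] (e f : A) : Prop :=
  ∀ x : A, (∀ y : A, (e * x * e) * (e * y * f) = 0) →
    (∀ y : A, (f * y * e) * (e * x * e) = 0) → e * x * e = 0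

theorem corner_commute {A : Type*} [Ring A] {e f : A} (h : ComplementaryIdem e f)
    (hQ : CornerFaithful e f) {x : A} (h1 : e * x * f = 0) (h2 : f * x * e = 0)
    (hM : ∀ m, (e * m * f) * x = x * (e * m * f))
    (hN : ∀ t, (f * t * e) * x = x * (f * t * e)) (y : A) :
    x * (e * y * e) = (e * y * e) * x := by
  have hxe : x * e = e * x * e := by
    calc x * e = (e + f) * x * e := by rw [h.add, one_mul]
      _ = e * x * e + f * x * e := by noncomm_ring
      _ = _ := by rw [h2, add_zero]
  have hex : e * x = e * x * e := by
    calc e * x = e * x * (e + f) := by rw [h.add, mul_one]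
      _ = e * x * e + e * x * f := by noncomm_ring
      _ = _ := by rw [h1, add_zero]
  have hc : x * e = e * x := hxe.trans hex.symm
  have key := hQ (x * (e * y * e) - (e * y * e) * x) ?_ ?_
  · have : e * (x * (e * y * e) - (e * y * e) * x) * e
        = x * (e * y * e) - (e * y * e) * x := by
      calc _ = (e * x) * (e * y * e) * e - e * (e * y * e) * (x * e) := by noncomm_ring
        _ = x * ((e * e) * y * (e * e)) - ((e * e) * y * (e * e)) * x := by
          rw [← hc, hc]
          conv_lhs => rw [← hc]
          simp only [mul_assoc, ← hc, h.ee, h.ee']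
          simp only [← mul_assoc, hc]
          simp only [mul_assoc, h.ee]
        _ = _ := by rw [h.ee]
    rw [this] at key
    exact sub_eq_zero.1 key
  · intro m
    have a1 := hM (e * y * e * m)
    have a2 := hM m
    simp only [mul_assoc, h.ee'] at a1 a2
    have hc' : ∀ z, x * (e * z) = e * (x * z) := fun z => by
      rw [← mul_assoc, hc, mul_assoc]
    simp only [mul_assoc, mul_sub, sub_mul, h.ee, h.ee', hc'] at a1 a2 ⊢
    rw [← a1, ← a2, sub_self]
  · intro t
    have a1 := hN (t * e * y * e)
    have a2 := hN t
    have hc' : ∀ z, x * (e * z) = e * (x * z) := fun z => by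
      rw [← mul_assoc, hc, mul_assoc]
    have a2' : ∀ z, f * (t * (e * (x * z))) = x * (f * (t * (e * z))) := fun z => by
      simpa only [mul_assoc] using congrArg (· * z) a2
    simp only [mul_assoc, mul_sub, sub_mul, h.ee, h.ee', hc, hc', a2'] at a1 a2 ⊢
    rw [a1, sub_self]

theorem isCent_of_commute {A : Type*} [Ring A] {e f : A} (h : ComplementaryIdem e f)
    (hQ : CornerFaithful e f) (hQ' : CornerFaithful f e) {x : A}
    (h1 : e * x * f = 0) (h2 : f * x * e = 0)
    (hM : ∀ m, (e * m * f) * x = x * (e * m * f))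
    (hN : ∀ t, (f * t * e) * x = x * (f * t * e)) : IsCent x := by
  intro y
  rw [h.decomp y]
  simp only [mul_add, add_mul]
  rw [corner_commute h hQ h1 h2 hM hN, corner_commute h.symm hQ' h2 h1 hN hM, hM, hN]

/-- `φ` satisfies the Leibniz rule for `pCom · k`. -/
def LeibnizAt {A : Type*} [Ring A] (k : ℕ) (φ : A → A) : Prop :=
  ∀ x : ℕ → A, φ (pCom x k) = dCom φ x k

section Leibniz

variable {A : Type*} [Ring A] {e f : A}

theorem pCom_peirce (h : ComplementaryIdem e f) {x : ℕ → A} {m : A}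
    (h0 : x 0 = e * m * f) (k : ℕ) (hx : ∀ i, 1 ≤ i → i ≤ k → x i = f) :
    pCom x k = e * m * f := by
  induction k with
  | zero => exact h0
  | succ k ih =>
    rw [pCom, ih fun i h1 h2 => hx i h1 (by omega), hx (k + 1) (by omega) le_rfl]
    simp only [mul_assoc, h.ff, h.symm.ef', sub_zero]

theorem peirce_dCom (h : ComplementaryIdem e f) (φ : A → A) (m : A) (k : ℕ) :
    e * dCom φ (fun i => if i = 0 then e * m * f else f) k * f =
      e * φ (e * m * f) * f + k • (e * ((e * m * f) * φ f - φ f * (e * m * f)) * f) := by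
  induction k with
  | zero => simp [dCom]
  | succ k ih =>
    rw [dCom, pCom_peirce (m := m) h (by simp) k (fun i h1 _ => by simp; omega)]
    rw [if_neg (by omega), succ_nsmul, ← add_assoc, ← ih]
    simp only [mul_add, add_mul, mul_sub, sub_mul, mul_assoc, h.ff, h.ef', sub_zero]

theorem LeibnizAt.peirce_commute (h : ComplementaryIdem e f) {φ : A → A} {k : ℕ}
    (hφ : LeibnizAt k φ) (hk : TorsionFreeAt A k) (m : A) :
    e * ((e * m * f) * φ f - φ f * (e * m * f)) * f = 0 := by
  have := congrArg (fun y => e * y * f) (hφ (fun i => if i = 0 then e * m * f else f))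
  simp only [peirce_dCom h] at this
  rw [pCom_peirce (m := m) h (by simp) k (fun i h1 _ => by simp; omega)] at this
  exact hk _ (by simpa using this)

theorem LeibnizAt.map_one_commute (h : ComplementaryIdem e f) {φ : A → A} {k : ℕ}
    (hφ : LeibnizAt (k + 1) φ) (h0 : φ 0 = 0) (m : A) :
    (e * m * f) * φ 1 = φ 1 * (e * m * f) := by
  have := hφ (fun i => if i = 0 then e * m * f else if i = k + 1 then 1 else f)
  simp only [pCom, dCom] at this
  rw [pCom_peirce (m := m) h (by simp) k
    (fun i h1 h2 => by rw [if_neg (by omega), if_neg (by omega)])] at this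
  refine sub_eq_zero.1 (Eq.symm ?_)
  simpa [h0] using this

theorem pCom_one {x : ℕ → A} (h0 : x 0 = 1) (k : ℕ) :
    pCom x (k + 1) = 0 := by
  induction k with
  | zero => simp [pCom, h0]
  | succ k ih => rw [pCom, ih]; simp

theorem LeibnizAt.peirce_map_one (h : ComplementaryIdem e f) {φ : A → A} {k : ℕ}
    (hφ : LeibnizAt (k + 1) φ) (h0 : φ 0 = 0) : e * φ 1 * f = 0 := by
  have hd : ∀ j, e * dCom φ (fun i => if i = 0 then 1 else f) j * f = e * φ 1 * f := by
    intro j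
    induction j with
    | zero => simp [dCom]
    | succ j ih =>
      have hp : ∀ y : A, pCom (fun i => if i = 0 then (1 : A) else f) j * y
          - y * pCom (fun i => if i = 0 then (1 : A) else f) j = 0 := by
        intro y
        cases j with
        | zero => simp [pCom]
        | succ j => rw [pCom_one (by simp)]; simp
      rw [dCom, hp, ← ih]
      simp only [add_zero, if_neg (Nat.succ_ne_zero j), mul_sub, mul_assoc, h.ff,
        h.ef', sub_zero]
  rw [← hd (k + 1), ← hφ, pCom_one (by simp), h0]
  simp

theorem LeibnizAt.exists_peirce (h : ComplementaryIdem e f) {φ : A → A} {k : ℕ}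
    (hφ : LeibnizAt (k + 1) φ) (hc : IsCent (φ f)) (m v : A) :
    ∃ y, e * y * f = e * φ (e * m * f) * f ∧
      φ ((e * m * f) * v - v * (e * m * f)) =
        (y * v - v * y) + ((e * m * f) * φ v - φ v * (e * m * f)) := by
  set x : ℕ → A := fun i => if i = 0 then e * m * f else if i = k + 1 then v else f with hx
  have hxf : ∀ i, 1 ≤ i → i ≤ k → x i = f := fun i h1 h2 => by
    simp only [hx]; rw [if_neg (by omega), if_neg (by omega)]
  have hp := pCom_peirce (m := m) h (x := x) (by simp [hx]) k hxf
  have hv : x (k + 1) = v := by simp [hx]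
  refine ⟨dCom φ x k, ?_, ?_⟩
  · have : ∀ j ≤ k, e * dCom φ x j * f = e * φ (e * m * f) * f := by
      intro j hj
      induction j with
      | zero => simp [dCom, hx]
      | succ j ih =>
        rw [dCom, hxf (j + 1) (by omega) hj, hc, sub_self, add_zero, ← ih (by omega)]
        simp only [mul_sub, mul_assoc, h.ff, h.ef', sub_zero]
    exact this k le_rfl
  · have := hφ x
    rwa [pCom, dCom, hp, hv] at this

variable {k : ℕ} {φ : A →+ A}

theorem LeibnizAt.peirce_left_mul (h : ComplementaryIdem e f)
    (hφ : LeibnizAt (k + 1) φ) (hc : IsCent (φ f)) (a m : A) :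
    e * φ ((e * a * e) * (e * m * f)) * f =
      (e * φ (e * a * e) * e) * (e * m * f) + (e * a * e) * (e * φ (e * m * f) * f)
        - (e * m * f) * (f * φ (e * a * e) * f) := by
  obtain ⟨y, hy, hyv⟩ := hφ.exists_peirce h hc m (e * a * e)
  have := congrArg (fun z => e * z * f) hyv
  rw [← hy]
  simp only [mul_add, add_mul, mul_sub, sub_mul, mul_assoc, h.ff, h.ef, h.ee',
    h.symm.ef', h.symm.ee', mul_zero, zero_sub, map_neg, mul_neg, neg_mul] at this ⊢
  rw [← neg_inj, this]
  abel

theorem LeibnizAt.peirce_right_mul (h : ComplementaryIdem e f)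
    (hφ : LeibnizAt (k + 1) φ) (hc : IsCent (φ f)) (b m : A) :
    e * φ ((e * m * f) * (f * b * f)) * f =
      (e * φ (e * m * f) * f) * (f * b * f) + (e * m * f) * (f * φ (f * b * f) * f)
        - (e * φ (f * b * f) * e) * (e * m * f) := by
  obtain ⟨y, hy, hyv⟩ := hφ.exists_peirce h hc m (f * b * f)
  have := congrArg (fun z => e * z * f) hyv
  rw [← hy]
  simp only [mul_add, add_mul, mul_sub, sub_mul, mul_assoc, h.ff, h.ee', h.ef',
    h.symm.ef', h.symm.ee', mul_zero, sub_zero] at this ⊢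
  rw [this]
  abel

theorem LeibnizAt.corner_commutator (h : ComplementaryIdem e f)
    (hφ : LeibnizAt (k + 1) φ) (hc : IsCent (φ f)) (m t : A) :
    e * φ ((e * m * f) * (f * t * e)) * e - e * φ ((f * t * e) * (e * m * f)) * e =
      (e * φ (e * m * f) * f) * (f * t * e) + (e * m * f) * (f * φ (f * t * e) * e) := by
  obtain ⟨y, hy, hyv⟩ := hφ.exists_peirce h hc m (f * t * e)
  have := congrArg (fun z => e * z * e) hyv
  rw [← hy]
  simp only [mul_add, add_mul, mul_sub, sub_mul, mul_assoc, h.ee, h.fe, h.ee', h.ef',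
    h.symm.ee', mul_zero, sub_zero, map_sub] at this ⊢
  rw [this]

end Leibniz

theorem isCent_map_idem {A : Type*} [Ring A] {e f : A} (h : ComplementaryIdem e f)
    (hQ : CornerFaithful e f) (hQ' : CornerFaithful f e) {k : ℕ} {φ : A →+ A}
    (hφ : LeibnizAt (k + 1) φ) (hk : TorsionFreeAt A (k + 1))
    (h1 : e * φ f * f = 0) (h2 : f * φ f * e = 0) : IsCent (φ e) ∧ IsCent (φ f) := by
  have hone : IsCent (φ 1) := isCent_of_commute h hQ hQ'
    (hφ.peirce_map_one h (map_zero φ)) (hφ.peirce_map_one h.symm (map_zero φ))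
    (hφ.map_one_commute h (map_zero φ)) (hφ.map_one_commute h.symm (map_zero φ))
  have hadd : φ 1 = φ e + φ f := by rw [← map_add, h.add]
  have hf : IsCent (φ f) := by
    have hcf : φ f * f = f * φ f := by
      calc φ f * f = (e + f) * φ f * f := by rw [h.add, one_mul]
        _ = f * φ f * (e + f) := by
          rw [add_mul, add_mul, mul_add, h1, h2]
        _ = _ := by rw [h.add, mul_one]
    have hce : φ f * e = e * φ f := by
      rw [eq_sub_of_add_eq h.add, mul_sub, sub_mul, hcf, mul_one, one_mul]
    have hcf' : ∀ x, φ f * (f * x) = f * (φ f * x) := fun x => by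
      rw [← mul_assoc, hcf, mul_assoc]
    have hce' : ∀ x, φ f * (e * x) = e * (φ f * x) := fun x => by
      rw [← mul_assoc, hce, mul_assoc]
    refine isCent_of_commute h hQ hQ' h1 h2 (fun m => ?_) fun t => ?_
    · have := hφ.peirce_commute h hk m
      simp only [mul_sub, sub_mul, mul_assoc, h.ff, h.ee', hcf, hce'] at this ⊢
      simpa only [h.symm.ee', h.ff, sub_eq_zero] using this
    · have := hφ.peirce_commute h.symm hk t
      rw [show φ e = φ 1 - φ f by rw [hadd]; abel] at this
      rw [mul_sub (f * t * e), sub_mul (φ 1), hone] at this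
      simp only [mul_sub, sub_mul, mul_assoc, h.ee, h.ee', h.symm.ee', hce, hcf'] at this ⊢
      rw [sub_sub_sub_cancel_left, sub_eq_zero] at this
      exact this.symm
  refine ⟨fun y => ?_, hf⟩
  rw [show φ e = φ 1 - φ f by rw [hadd]; abel, mul_sub, sub_mul, hone, hf]

theorem peirce_mul_central {A : Type*} [Ring A] {e f : A} (h : ComplementaryIdem e f) {z : A}
    (hz : IsCent z) (m : A) : (e * m * f) * (f * z * f) = (e * z * e) * (e * m * f) := by
  rw [← hz f, ← hz e]
  calc (e * m * f) * (z * f * f) = ((e * m * f) * z) * (f * f) := by noncomm_ring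
    _ = _ := by rw [← hz]; simp only [mul_assoc, h.ff, h.ee']

theorem isCent_of_noNonzeroCentralIdeal {R A : Type*} [CommRing R] [Ring A] [Algebra R A]
    {e f : A} (h : ComplementaryIdem e f) (hQ : CornerFaithful e f) {k : ℕ} {φ : A →+ A}
    (hφ : LeibnizAt (k + 1) φ) (hce : IsCent (φ e)) (hcf : IsCent (φ f))
    (hie : ∀ a, ∃ z, IsCent z ∧ f * φ (e * a * e) * f = f * z * f)
    (hif : ∀ b, ∃ z, IsCent z ∧ e * φ (f * b * f) * e = e * z * e)
    (hii : NoNonzeroCentralIdeal R A e) (m t : A) :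
    IsCent (e * φ ((f * t * e) * (e * m * f)) * e +
      f * φ ((e * m * f) * (f * t * e)) * f) := by
  choose z hz hzφ using hie
  choose z' hz' hzφ' using hif
  obtain ⟨G, hG⟩ : ∃ G : A → A, ∀ a, e * φ (e * a * e) * e = G a + e * z a * e :=
    ⟨fun a => e * φ (e * a * e) * e - e * z a * e, fun a => (sub_add_cancel _ _).symm⟩
  have hGe : ∀ a, e * G a * e = G a := fun a => by
    rw [eq_sub_of_add_eq (hG a).symm]
    simp only [mul_sub, sub_mul, mul_assoc, h.ee, h.ee']
  have hM : ∀ a m, e * φ ((e * a * e) * (e * m * f)) * f =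
      G a * (e * m * f) + (e * a * e) * (e * φ (e * m * f) * f) := by
    intro a m
    rw [hφ.peirce_left_mul h hcf, hzφ, hG, peirce_mul_central h (hz a)]
    noncomm_ring
  have hN : ∀ a t, f * φ ((f * t * e) * (e * a * e)) * e =
      (f * φ (f * t * e) * e) * (e * a * e) + (f * t * e) * G a := by
    intro a t
    rw [hφ.peirce_right_mul h.symm hce, hzφ, hG, ← peirce_mul_central h.symm (hz a)]
    noncomm_ring
  have hder : ∀ a b, G (a * e * b) = G a * (e * b * e) + (e * a * e) * G b := by
    intro a b
    have hX : e * (G (a * e * b) - (G a * (e * b * e) + (e * a * e) * G b)) * e =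
        G (a * e * b) - (G a * (e * b * e) + (e * a * e) * G b) := by
      conv_rhs => rw [← hGe (a * e * b), ← hGe a, ← hGe b]
      simp only [mul_sub, sub_mul, mul_add, add_mul, mul_assoc, h.ee, h.ee']
    rw [← sub_eq_zero, ← hX]
    refine hQ _ (fun m => ?_) (fun t => ?_)
    · rw [hX]
      have h1 := hM (a * e * b) m
      have h2 := hM a (e * b * e * m)
      have h3 := hM b m
      have hGl : ∀ x, e * (G b * x) = G b * x := fun x => by
        rw [← hGe b]
        simp only [mul_assoc, h.ee']
      simp only [sub_mul, add_mul, mul_assoc, h.ee', hGl] at h1 h2 h3 ⊢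
      rw [h1, h3] at h2
      simp only [mul_add] at h2
      rw [← sub_eq_zero.2 h2]
      abel
    · rw [hX]
      have h1 := hN (a * e * b) t
      have h2 := hN b (t * e * a * e)
      have h3 := congrArg (· * (e * b * e)) (hN a t)
      simp only [mul_sub, mul_add, add_mul, mul_assoc, h.ee, h.ee'] at h1 h2 h3 ⊢
      rw [h1, h3] at h2
      rw [← sub_eq_zero.2 h2]
      abel
  set E : A → A → A := fun m t => (e * φ (e * m * f) * f) * (f * t * e) +
    (e * m * f) * (f * φ (f * t * e) * e) - G (m * f * t) with hEdef
  have hE : ∀ m t, E m t = e * (z (m * f * t) - z' (t * e * m)) * e := by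
    intro m t
    have h1 := hG (m * f * t)
    have h2 := hzφ' (t * e * m)
    simp only [hEdef]
    rw [← hφ.corner_commutator h hcf m t,
      show (e * m * f) * (f * t * e) = e * (m * f * t) * e by
        simp only [mul_assoc, h.symm.ee'],
      show (f * t * e) * (e * m * f) = f * (t * e * m) * f by
        simp only [mul_assoc, h.ee'], h1, h2]
    noncomm_ring
  have hEe : ∀ m t, E m t = e * E m t * e := by
    intro m t
    rw [hE]
    simp only [mul_assoc, h.ee, h.ee']
  have hEc : ∀ m t a, E m t * (e * a * e) = (e * a * e) * E m t := by
    intro m t a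
    rw [hE]
    have hc : IsCent (z (m * f * t) - z' (t * e * m)) := fun y => by
      rw [sub_mul, mul_sub, hz, hz']
    generalize z (m * f * t) - z' (t * e * m) = c at hc
    rw [← hc e]
    simp only [mul_assoc, h.ee, h.ee']
    rw [hc e, h.ee', hc]
    simp only [mul_assoc]
  have hEm : ∀ a m t, (e * a * e) * E m t = E (a * e * m) t := by
    intro a m t
    have h1 := congrArg (· * (f * t * e)) (hM a m)
    have h2 := hder a (m * f * t)
    simp only [hEdef]
    simp only [mul_sub, mul_add, add_mul, mul_assoc, h.ee', h.symm.ee'] at h1 h2 ⊢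
    rw [h1, h2]
    abel
  have hE0 : ∀ m t, E m t = 0 := by
    intro m t
    have hspan : ∀ x ∈ Submodule.span R (Set.range fun p : A × A => E p.1 p.2),
        x = e * x * e ∧ ∀ a, x * (e * a * e) = (e * a * e) * x ∧
          (e * a * e) * x ∈ Submodule.span R (Set.range fun p : A × A => E p.1 p.2) := by
      intro x hx
      induction hx using Submodule.span_induction with
      | mem x hx =>
        obtain ⟨p, rfl⟩ := hx
        refine ⟨hEe _ _, fun a => ⟨hEc _ _ _, ?_⟩⟩
        rw [hEm]
        exact Submodule.subset_span ⟨(a * e * p.1, p.2), rfl⟩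
      | zero => simp
      | add x y _ _ hx hy =>
        refine ⟨by rw [mul_add, add_mul, ← hx.1, ← hy.1], fun a => ⟨?_, ?_⟩⟩
        · rw [mul_add, add_mul, (hx.2 a).1, (hy.2 a).1]
        · rw [mul_add]
          exact Submodule.add_mem _ (hx.2 a).2 (hy.2 a).2
      | smul r x _ hx =>
        refine ⟨by rw [mul_smul_comm, smul_mul_assoc, ← hx.1], fun a => ⟨?_, ?_⟩⟩
        · rw [mul_smul_comm, smul_mul_assoc, (hx.2 a).1]
        · rw [mul_smul_comm]
          exact Submodule.smul_mem _ _ (hx.2 a).2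
    refine hii (Submodule.span R (Set.range fun p : A × A => E p.1 p.2) : Set A)
      (Submodule.zero_mem _) (fun x hx => (hspan x hx).1)
      (fun x hx y hy => Submodule.add_mem _ hx hy)
      (fun r x hx => Submodule.smul_mem _ r hx) (fun x hx a => ((hspan x hx).2 a).2)
      (fun x hx a => ?_) (fun x hx a => ((hspan x hx).2 a).1) _
      (Submodule.subset_span ⟨(m, t), rfl⟩)
    rw [((hspan x hx).2 a).1]
    exact ((hspan x hx).2 a).2
  have hzz : e * z (m * f * t) * e = e * z' (t * e * m) * e := by
    have := hE m t
    rw [hE0, mul_sub, sub_mul] at this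
    exact (sub_eq_zero.1 this.symm)
  rw [show (e * m * f) * (f * t * e) = e * (m * f * t) * e by
      simp only [mul_assoc, h.symm.ee'],
    show (f * t * e) * (e * m * f) = f * (t * e * m) * f by
      simp only [mul_assoc, h.ee'], hzφ, hzφ', ← hzz]
  have hez : e * z (m * f * t) * e + f * z (m * f * t) * f = z (m * f * t) := by
    have hc := hz (m * f * t)
    generalize z (m * f * t) = c at hc
    rw [← hc e, ← hc f, mul_assoc, mul_assoc, h.ee, h.ff, ← mul_add, h.add, mul_one]
  rw [hez]
  exact hz _

theorem isCent_of_leibnizAt {R A : Type*} [CommRing R] [Ring A] [Algebra R A]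
    {e f : A} (h : ComplementaryIdem e f) (hQ : CornerFaithful e f) (hQ' : CornerFaithful f e)
    {k : ℕ} {φ : A →+ A} (hφ : LeibnizAt (k + 1) φ) (hk : TorsionFreeAt A (k + 1))
    (hie : ∀ a, ∃ z, IsCent z ∧ f * φ (e * a * e) * f = f * z * f)
    (hif : ∀ b, ∃ z, IsCent z ∧ e * φ (f * b * f) * e = e * z * e)
    (hii : NoNonzeroCentralIdeal R A e ∨ NoNonzeroCentralIdeal R A f) (m t : A) :
    IsCent (e * φ ((f * t * e) * (e * m * f)) * e +
      f * φ ((e * m * f) * (f * t * e)) * f) := by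
  set w := f * φ f * e - e * φ f * f with hw
  set ψ : A →+ A := φ - (AddMonoidHom.mulRight w - AddMonoidHom.mulLeft w) with hψdef
  have hψ : ∀ x, ψ x = φ x - (x * w - w * x) := fun x => rfl
  have hψL : LeibnizAt (k + 1) ψ := by
    intro x
    rw [hψ, hφ, ← dCom_sub_commutator]
    rfl
  have hee : ∀ a, e * ψ (f * a * f) * e = e * φ (f * a * f) * e := fun a => by
    rw [hψ]
    simp only [mul_sub, sub_mul, mul_assoc, h.fe, h.ef', mul_zero, zero_mul, sub_zero]
  have hff : ∀ a, f * ψ (e * a * e) * f = f * φ (e * a * e) * f := fun a => by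
    rw [hψ]
    simp only [mul_sub, sub_mul, mul_assoc, h.ef, h.symm.ef', mul_zero, zero_mul, sub_zero]
  obtain ⟨hce, hcf⟩ := isCent_map_idem h hQ hQ' hψL hk
    (by
      rw [hψ, hw]
      simp only [mul_sub, sub_mul, mul_assoc, h.ef, h.ee', h.ef', h.symm.ee',
        h.ff, h.symm.ef', mul_add, mul_zero, sub_zero, zero_sub, sub_neg_eq_add, zero_add,
        sub_self])
    (by
      rw [hψ, hw]
      simp only [mul_sub, sub_mul, mul_assoc, h.ef, h.symm.ee', h.ee,
        h.ff, h.symm.ef', mul_neg, mul_zero, sub_zero, zero_sub, neg_zero, sub_zero, sub_self])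
  simp only [← hee, ← hff] at hie hif
  have hmt : (e * m * f) * (f * t * e) = e * (m * f * t) * e := by
    simp only [mul_assoc, h.symm.ee']
  have htm : (f * t * e) * (e * m * f) = f * (t * e * m) * f := by
    simp only [mul_assoc, h.ee']
  have key : IsCent (e * ψ ((f * t * e) * (e * m * f)) * e +
      f * ψ ((e * m * f) * (f * t * e)) * f) := by
    rcases hii with hii | hii
    · exact isCent_of_noNonzeroCentralIdeal h hQ hψL hce hcf hie hif hii m t
    · rw [add_comm]
      exact isCent_of_noNonzeroCentralIdeal h.symm hQ' hψL hcf hce hif hie hii t m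
  rw [hmt, htm] at key ⊢
  rwa [hee, hff] at key

theorem stmt_7 (R : Type*) [CommRing R] (A : Type*) [Ring A] [Algebra R A]
    (n : ℕ) (hn : 2 ≤ n)
    (hn1 : TorsionFreeAt A (n - 1))
    (e : A) (he : e * e = e) (he0 : e ≠ 0) (he1 : e ≠ 1) (hQ : PropQ e)
    (φ : A →ₗ[R] A) (hφ : IsLieNDeriv n φ)
    (hi : (∀ a : A, ∃ z : A, IsCent z ∧
          (1 - e) * φ (e * a * e) * (1 - e) = (1 - e) * z * (1 - e)) ∧
        (∀ b : A, ∃ z : A, IsCent z ∧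
          e * φ ((1 - e) * b * (1 - e)) * e = e * z * e))
    (hii : NoNonzeroCentralIdeal R A e ∨ NoNonzeroCentralIdeal R A (1 - e)) :
    ∀ m t : A, IsCent
      (e * φ (((1 - e) * t * e) * (e * m * (1 - e))) * e +
       (1 - e) * φ ((e * m * (1 - e)) * ((1 - e) * t * e)) * (1 - e)) := by
  obtain ⟨k, rfl⟩ : ∃ k, n = k + 2 := ⟨n - 2, by omega⟩
  intro m t
  refine isCent_of_leibnizAt (R := R) (φ := φ.toAddMonoidHom) (k := k)
    (ComplementaryIdem.of_idem he) (fun x h1 h2 => hQ.1 x ⟨h1, h2⟩)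
    (fun x h1 h2 => hQ.2 x ⟨h2, h1⟩) (fun x => ?_) hn1 hi.1 hi.2 hii m t
  exact (hφ x).trans (sum_pCom_update φ x (k + 1))
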